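/- arXiv:2507.10138 — 3 statements merged into one kernel-verified Lean document; each statement's English description precedes it below -/
import Mathlib

section
/- Let α be a monic real polynomial of degree 3 and β a real polynomial. There exists a unique tuple (k_{10}, k_{12}, k_{13}, k_{21}, k_{31}) ∈ ℝ⁵ of strictly positive numbers with k_{21} < k_{31} such that the associated 3×3 mammillary matrix A, with B = (1,0,0)ᵀ and C = (1,0,0), satisfies C · adj(sI − A) · B = β(s) and det(sI − A) = α(s) if and only if: β is a monic polynomial of degree 2 with two distinct real strictly negative roots z_2 > z_3, and moreover α(0) > 0, α(z_2) < 0, and α(z_3) > 0. -/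
open Polynomial

/-- The 3-compartment mammillary matrix with parameters
`(k10, k12, k13, k21, k31)`. -/
def mam3 (k10 k12 k13 k21 k31 : ℝ) : Matrix (Fin 3) (Fin 3) ℝ :=
  !![-k10 - k12 - k13, k21, k31;
     k12, -k21, 0;
     k13, 0, -k31]

lemma mam3_adj (a b c p q : ℝ) :
    (Matrix.charmatrix (mam3 a b c p q)).adjugate 0 0 = (X - C (-p)) * (X - C (-q)) := by
  rw [Matrix.adjugate_fin_three]
  simp [mam3, Matrix.charmatrix_apply]

lemma mam3_char (a b c p q x : ℝ) :
    (mam3 a b c p q).charpoly.eval x =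
      (x + a + b + c) * (x + p) * (x + q) - b * p * (x + q) - c * q * (x + p) := by
  rw [Matrix.charpoly, Matrix.det_fin_three]
  simp [mam3, Matrix.charmatrix_apply]
  ring

lemma cubic_eval (α : Polynomial ℝ) (hα : α.Monic) (hdeg : α.natDegree = 3) :
    ∃ a b c : ℝ, ∀ x, α.eval x = x ^ 3 + a * x ^ 2 + b * x + c := by
  refine ⟨α.coeff 2, α.coeff 1, α.coeff 0, fun x => ?_⟩
  have h : α.coeff 3 = 1 := by rw [← hdeg]; exact hα
  rw [Polynomial.eval_eq_sum_range, hdeg]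
  simp [Finset.sum_range_succ, h]
  ring

/-- the transfer function `β/α` (with `α` monic of degree 3) admits a
unique *positive* realization by a 3-compartment mammillary model (with the
normalization `k21 < k31`) iff `β` is monic of degree 2 with two distinct real
strictly negative roots `z₂ > z₃` and `α(0) > 0`, `α(z₂) < 0`, `α(z₃) > 0`. -/
theorem mam3_positive_realization_iff
    (α β : Polynomial ℝ) (hα : α.Monic) (hdeg : α.natDegree = 3) :
    (∃! k : ℝ × ℝ × ℝ × ℝ × ℝ,
        0 < k.1 ∧ 0 < k.2.1 ∧ 0 < k.2.2.1 ∧ 0 < k.2.2.2.1 ∧ 0 < k.2.2.2.2 ∧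
        k.2.2.2.1 < k.2.2.2.2 ∧
        (Matrix.charmatrix (mam3 k.1 k.2.1 k.2.2.1 k.2.2.2.1 k.2.2.2.2)).adjugate 0 0
          = β ∧
        (mam3 k.1 k.2.1 k.2.2.1 k.2.2.2.1 k.2.2.2.2).charpoly = α) ↔
      (∃ z₂ z₃ : ℝ, z₃ < z₂ ∧ z₂ < 0 ∧
        β = (X - C z₂) * (X - C z₃) ∧
        0 < α.eval 0 ∧ α.eval z₂ < 0 ∧ 0 < α.eval z₃) := by
  constructor
  · rintro ⟨⟨a, b, c, p, q⟩, ⟨ha, hb, hc, hp, hq, hpq, h1, h2⟩, -⟩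
    dsimp only at *
    refine ⟨-p, -q, by linarith, by linarith, ?_, ?_, ?_, ?_⟩
    · rw [← h1, mam3_adj]
    · rw [← h2, mam3_char]
      have : 0 < a * p * q := by positivity
      linarith
    · rw [← h2, mam3_char]
      have : 0 < b * p * (q - p) := mul_pos (mul_pos hb hp) (by linarith)
      linarith
    · rw [← h2, mam3_char]
      have : 0 < c * q * (q - p) := mul_pos (mul_pos hc hq) (by linarith)
      linarith
  · rintro ⟨y, z, hzy, hy, hβ, h0, h2, h3⟩
    obtain ⟨p, rfl⟩ : ∃ p, y = -p := ⟨-y, by ring⟩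
    obtain ⟨q, rfl⟩ : ∃ q, z = -q := ⟨-z, by ring⟩
    have hp : 0 < p := by linarith
    have hpq : 0 < q - p := by linarith
    have hq : 0 < q := by linarith
    have hp' := hp.ne'
    have hq' := hq.ne'
    have hpq' := hpq.ne'
    refine ⟨(α.eval 0 / (p * q), -α.eval (-p) / (p * (q - p)), α.eval (-q) / (q * (q - p)), p, q),
      ⟨by positivity, div_pos (by linarith) (by positivity), by positivity, hp, hq,
        by dsimp only; linarith, ?_, ?_⟩, ?_⟩
    · dsimp only
      rw [mam3_adj, hβ]
    · obtain ⟨a, b, c, h⟩ := cubic_eval α hα hdeg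
      apply Polynomial.funext
      intro x
      dsimp only
      rw [mam3_char]
      simp only [h]
      field_simp
      ring
    · rintro ⟨a, b, c, r, s⟩ ⟨ha, hb, hc, hr, hs, hrs, e1, e2⟩
      dsimp only at *
      rw [mam3_adj, hβ] at e1
      have f1 := congrArg (Polynomial.eval (-r)) e1
      have f2 := congrArg (Polynomial.eval (-s)) e1
      have f3 := congrArg (Polynomial.eval (-p)) e1
      simp at f1 f2 f3
      have hr' : r = p := by grind
      have hs' : s = q := by grind
      subst hr' hs'
      rw [← e2]
      simp only [mam3_char, Prod.mk.injEq, and_true]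
      refine ⟨?_, ?_, ?_⟩
      · field_simp
        ring
      · field_simp
        ring
      · field_simp
        ring
end

section
/- Let n ≥ 2, let α be a monic real polynomial of degree n and β a real polynomial. There exists a unique parameter vector p = (k_{10}, k_{21},…,k_{n1}, k_{12},…,k_{1n}) ∈ ℝ^{2n−1} with all entries strictly positive and k_{21} < k_{31} < ⋯ < k_{n1}, such that the associated n×n mammillary matrix A_p, with B = e_1 and C = e_1ᵀ, satisfies C · adj(sI − A_p) · B = β(s) and det(sI − A_p) = α(s), if and only if: (i) β is a monic polynomial of degree n−1 with n−1 pairwise distinct real strictly negative roots z_2 > z_3 > ⋯ > z_n; (ii) α(0)/β(0) > 0; and (iii) for every root z_i of β, α(z_i)/β_i(z_i) > 0, where β_i(s) := z_i · β(s)/(s − z_i). -/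
open Polynomial Finset

/-- The `(n+2)`-compartment mammillary matrix (so the number of compartments is at
least 2) with elimination rate `k10` from the central compartment (index `0`), rates
`kin i` (= `k_{i1}`) from peripheral compartment `i` to the central one, and rates
`kout i` (= `k_{1i}`) from the central compartment to peripheral compartment `i`. -/
def mammillary (n : ℕ) (k10 : ℝ) (kin kout : Fin (n + 2) → ℝ) :
    Matrix (Fin (n + 2)) (Fin (n + 2)) ℝ :=
  Matrix.of fun i j =>
    if i = 0 then
      if j = 0 then -k10 - ∑ l ∈ Finset.univ.filter (fun l => l ≠ (0 : Fin (n + 2))), kout l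
      else kin j
    else if j = 0 then kout i
    else if i = j then -kin i
    else 0

theorem arrow_det {R : Type*} [CommRing R] [IsDomain R] (m : ℕ) (a : R) (b c d : Fin m → R)
    (hd : ∀ i, d i ≠ 0) (M : Matrix (Fin (m+1)) (Fin (m+1)) R)
    (h00 : M 0 0 = a) (h0 : ∀ j : Fin m, M 0 j.succ = b j) (h1 : ∀ i : Fin m, M i.succ 0 = c i)
    (h2 : ∀ i j : Fin m, M i.succ j.succ = if i = j then d i else 0) :
    M.det = a * ∏ i, d i - ∑ i, b i * c i * ∏ j ∈ Finset.univ.erase i, d j := by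
  have hP : ∏ i, d i ≠ 0 := Finset.prod_ne_zero_iff.mpr fun i _ => hd i
  let L : Matrix (Fin (m+1)) (Fin (m+1)) R := Matrix.of fun i j =>
    Fin.cases (Fin.cases (∏ i, d i) (fun i => - (c i * ∏ j ∈ Finset.univ.erase i, d j)) i)
      (fun j => if i = j.succ then 1 else 0) j
  have L0 : L 0 0 = ∏ i, d i := rfl
  have L1 : ∀ i : Fin m, L i.succ 0 = - (c i * ∏ j ∈ Finset.univ.erase i, d j) := fun i => rfl
  have L2 : ∀ i j, L i (Fin.succ j) = if i = j.succ then 1 else 0 := fun i j => rfl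
  have hL : L.det = ∏ i, d i := by
    rw [Matrix.det_of_isLowerTriangular]
    · rw [Fin.prod_univ_succ, L0]; simp [L2]
    · intro i j hij
      have hij : i < j := hij
      refine Fin.cases (fun h => absurd h (by simp)) (fun j h => ?_) j hij
      rw [L2, if_neg h.ne]
  have hML : (M * L).det = (a * ∏ i, d i - ∑ i, b i * c i * ∏ j ∈ Finset.univ.erase i, d j)
      * ∏ i, d i := by
    rw [Matrix.det_of_isUpperTriangular]
    · rw [Fin.prod_univ_succ]
      congr 1
      · rw [Matrix.mul_apply, Fin.sum_univ_succ, L0, h00]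
        simp only [h0, L1]
        rw [sub_eq_add_neg, ← Finset.sum_neg_distrib]
        congr 1
        exact Finset.sum_congr rfl fun i _ => by ring
      · refine Finset.prod_congr rfl fun i _ => ?_
        rw [Matrix.mul_apply]
        simp [L2, h2]
    · intro i j hij
      have hij : j < i := hij
      refine Fin.cases (fun h => absurd h (by simp)) (fun i h => ?_) i hij
      refine Fin.cases (fun h => ?_) (fun j h => ?_) j h
      · rw [Matrix.mul_apply, Fin.sum_univ_succ, L0, h1]
        simp only [L1, h2]
        simp only [ite_mul, zero_mul, Finset.sum_ite_eq, Finset.mem_univ, if_true]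
        rw [← Finset.mul_prod_erase Finset.univ d (Finset.mem_univ i)]
        ring
      · rw [Matrix.mul_apply]
        have : i ≠ j := by rintro rfl; exact lt_irrefl _ h
        simp [L2, h2, this]
  rw [Matrix.det_mul, hL] at hML
  exact mul_right_cancel₀ hP hML

theorem filt_eq (n : ℕ) : (Finset.univ.filter (fun i => i ≠ (0 : Fin (n + 2)))) =
    Finset.univ.map (Fin.succEmb (n+1)) := by
  ext i
  refine Fin.cases ?_ (fun i => ?_) i <;> simp [Fin.succ_ne_zero]

theorem filt_erase_eq (n : ℕ) (i : Fin (n+1)) :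
    (Finset.univ.filter (fun i => i ≠ (0 : Fin (n + 2)))).erase i.succ =
    (Finset.univ.erase i).map (Fin.succEmb (n+1)) := by
  rw [filt_eq, Finset.map_erase]; rfl

theorem mam_adj (n : ℕ) (k : ℝ) (u v : Fin (n+2) → ℝ) :
    (Matrix.charmatrix (mammillary n k u v)).adjugate 0 0 =
      ∏ i : Fin (n+1), (X - C (- u i.succ)) := by
  rw [Matrix.adjugate_fin_succ_eq_det_submatrix]
  have : (Matrix.charmatrix (mammillary n k u v)).submatrix (Fin.succAbove 0) (Fin.succAbove 0) =
      Matrix.diagonal fun i : Fin (n+1) => (X - C (- u i.succ)) := by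
    ext1 i j
    by_cases h : i = j
    · subst h
      simp [mammillary, Fin.succ_ne_zero]
    · simp [mammillary, Fin.succ_ne_zero, h]
  rw [this, Matrix.det_diagonal]
  simp

theorem mam_char (n : ℕ) (k : ℝ) (u v : Fin (n+2) → ℝ) :
    (mammillary n k u v).charpoly =
      (X - C (-k - ∑ i : Fin (n+1), v i.succ)) * ∏ i : Fin (n+1), (X - C (- u i.succ))
      - ∑ i : Fin (n+1), (-C (u i.succ)) * (-C (v i.succ)) *
          ∏ j ∈ Finset.univ.erase i, (X - C (- u j.succ)) := by
  unfold Matrix.charpoly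
  apply arrow_det
  · intro i; exact X_sub_C_ne_zero _
  · simp [mammillary, filt_eq]
  · intro j; simp [mammillary, Fin.succ_ne_zero, (Fin.succ_ne_zero _).symm]
  · intro j; simp [mammillary, Fin.succ_ne_zero]
  · intro i j
    by_cases h : i = j
    · subst h
      simp [mammillary, Fin.succ_ne_zero]
    · simp [mammillary, Fin.succ_ne_zero, h]

theorem mam_eval0 (n : ℕ) (k : ℝ) (u v : Fin (n+2) → ℝ) :
    (mammillary n k u v).charpoly.eval 0 = k * ∏ i : Fin (n+1), u i.succ := by
  rw [mam_char]
  simp only [eval_sub, eval_mul, eval_X, eval_C, eval_prod, eval_finsetSum, eval_neg, zero_sub,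
    neg_neg]
  have : ∀ i : Fin (n+1), -u i.succ * -v i.succ * ∏ j ∈ Finset.univ.erase i, u j.succ =
      v i.succ * ∏ j : Fin (n+1), u j.succ := by
    intro i
    rw [← Finset.mul_prod_erase Finset.univ (fun j : Fin (n+1) => u j.succ) (Finset.mem_univ i)]
    ring
  rw [Finset.sum_congr rfl fun i _ => this i, ← Finset.sum_mul]
  ring

theorem mam_evalz (n : ℕ) (k : ℝ) (u v : Fin (n+2) → ℝ) (i : Fin (n+1)) :
    (mammillary n k u v).charpoly.eval (-u i.succ) =
      v i.succ * (-u i.succ * ∏ j ∈ Finset.univ.erase i, (-u i.succ - -u j.succ)) := by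
  rw [mam_char]
  simp only [eval_sub, eval_mul, eval_X, eval_C, eval_prod, eval_finsetSum, eval_neg]
  rw [Finset.prod_eq_zero (Finset.mem_univ i) (by ring), mul_zero,
    Finset.sum_eq_single i]
  · ring
  · intro b _ hb
    rw [Finset.prod_eq_zero (i := i) (by simp [hb.symm]) (by ring), mul_zero]
  · simp

theorem roots_inj (m : ℕ) (f g : Fin m → ℝ) (hf : StrictMono f) (hg : StrictMono g)
    (h : ∏ i, (X - C (-f i)) = ∏ i, (X - C (-g i))) : f = g := by
  rw [← hf.range_inj hg]
  have key : ∀ (f g : Fin m → ℝ), ∏ i, (X - C (-f i)) = ∏ i, (X - C (-g i)) →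
      Set.range f ⊆ Set.range g := by
    rintro f g h _ ⟨i, rfl⟩
    have h2 := congrArg (eval (-f i)) h
    simp only [eval_prod, eval_sub, eval_X, eval_C] at h2
    rw [Finset.prod_eq_zero (Finset.mem_univ i) (by ring)] at h2
    obtain ⟨j, _, hj⟩ := Finset.prod_eq_zero_iff.mp h2.symm
    exact ⟨j, by linarith⟩
  exact Set.Subset.antisymm (key f g h) (key g f h.symm)

/-- the transfer function `β/α` (with `α` monic of degree `n`) admits a
unique *strictly positive* realization by an `n`-compartment mammillary model
(parameter vector `p = (k10, kin, kout)` normalized by `kin 0 = kout 0 = 0`, all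
`2n − 1` meaningful entries strictly positive, and ordered by
`k_{21} < k_{31} < ⋯ < k_{n1}`) iff `β` is monic of degree `n − 1` with `n − 1`
pairwise distinct strictly negative real roots `z₂ > z₃ > ⋯ > z_n`,
`α(0)/β(0) > 0`, and for every root `z_i`, `α(z_i)/β_i(z_i) > 0`, where
`β_i(z_i) = z_i ∏_{j ≠ i} (z_i − z_j)`. -/
theorem mammillary_positive_realization_iff
    (n : ℕ) (α β : Polynomial ℝ) (hα : α.Monic) (hdeg : α.natDegree = n + 2) :
    (∃! p : ℝ × (Fin (n + 2) → ℝ) × (Fin (n + 2) → ℝ),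
        p.2.1 0 = 0 ∧ p.2.2 0 = 0 ∧
        0 < p.1 ∧
        (∀ i : Fin (n + 2), i ≠ 0 → 0 < p.2.1 i ∧ 0 < p.2.2 i) ∧
        (∀ i j : Fin (n + 2), 0 < i → i < j → p.2.1 i < p.2.1 j) ∧
        (Matrix.charmatrix (mammillary n p.1 p.2.1 p.2.2)).adjugate 0 0 = β ∧
        (mammillary n p.1 p.2.1 p.2.2).charpoly = α) ↔
      (∃ z : Fin (n + 2) → ℝ,
        (∀ i j : Fin (n + 2), 0 < i → i < j → z j < z i) ∧
        (∀ i : Fin (n + 2), i ≠ 0 → z i < 0) ∧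
        β = ∏ i ∈ Finset.univ.filter (fun i => i ≠ (0 : Fin (n + 2))), (X - C (z i)) ∧
        0 < α.eval 0 / β.eval 0 ∧
        (∀ i : Fin (n + 2), i ≠ 0 →
          0 < α.eval (z i) /
            (z i * ∏ j ∈ (Finset.univ.filter (fun j => j ≠ (0 : Fin (n + 2)))).erase i,
              (z i - z j)))) := by
  have hinj : ∀ w : Fin (n+1) → ℝ, StrictMono w → ∀ i : Fin (n+1),
      ∏ j ∈ Finset.univ.erase i, (-w i - -w j) ≠ 0 := by
    intro w hw i
    refine Finset.prod_ne_zero_iff.mpr fun j hj => ?_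
    intro h0
    exact (Finset.ne_of_mem_erase hj) (hw.injective (by linarith))
  constructor
  · rintro ⟨⟨k, u, v⟩, ⟨-, -, hk, hpos, hord, hβ, hα'⟩, -⟩
    dsimp only at hk hpos hord hβ hα'
    have hmono : StrictMono fun i : Fin (n+1) => u i.succ := fun i j hij =>
      hord _ _ (Fin.succ_pos _) (Fin.succ_lt_succ_iff.mpr hij)
    have hup : ∀ i : Fin (n+1), 0 < u i.succ := fun i => (hpos _ (Fin.succ_ne_zero i)).1
    refine ⟨fun i => - u i, fun i j hi hij => neg_lt_neg (hord i j hi hij),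
      fun i hi => neg_lt_zero.mpr (hpos i hi).1, ?_, ?_, ?_⟩
    · rw [← hβ, mam_adj, filt_eq, Finset.prod_map]; rfl
    · rw [← hβ, ← hα', mam_adj, mam_eval0]
      simp only [eval_prod, eval_sub, eval_X, eval_C, zero_sub, neg_neg]
      rw [mul_div_cancel_right₀ _ (Finset.prod_pos fun i _ => hup i).ne']
      exact hk
    · intro i hi
      obtain ⟨i, rfl⟩ := Fin.exists_succ_eq.mpr hi
      rw [filt_erase_eq, Finset.prod_map, ← hα', mam_evalz]
      simp only [Fin.coe_succEmb]
      rw [mul_div_cancel_right₀]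
      · exact (hpos _ hi).2
      · exact mul_ne_zero (neg_ne_zero.mpr (hup i).ne') (hinj _ hmono i)
  · rintro ⟨z, hord, hneg, hβ, h0, hz⟩
    have hmono : StrictMono fun i : Fin (n+1) => - z i.succ := fun i j hij =>
      neg_lt_neg (hord _ _ (Fin.succ_pos _) (Fin.succ_lt_succ_iff.mpr hij))
    have hzn : ∀ i : Fin (n+1), z i.succ < 0 := fun i => hneg _ (Fin.succ_ne_zero i)
    rw [filt_eq, Finset.prod_map] at hβ
    simp only [Fin.coe_succEmb] at hβ
    have hz' : ∀ i : Fin (n+1), 0 < α.eval (z i.succ) /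
        (z i.succ * ∏ j ∈ Finset.univ.erase i, (z i.succ - z j.succ)) := by
      intro i
      have := hz _ (Fin.succ_ne_zero i)
      rwa [filt_erase_eq, Finset.prod_map] at this
    have hne : ∀ i : Fin (n+1),
        z i.succ * ∏ j ∈ Finset.univ.erase i, (z i.succ - z j.succ) ≠ 0 := by
      intro i
      have := hinj _ hmono i
      simp only [neg_neg] at this
      exact mul_ne_zero (hzn i).ne this
    have hβ0 : β.eval 0 = ∏ i : Fin (n+1), -z i.succ := by
      rw [hβ]; simp only [eval_prod, eval_sub, eval_X, eval_C, zero_sub]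
    have hβ0' : β.eval 0 ≠ 0 := by
      rw [hβ0]; exact (Finset.prod_pos fun i _ => neg_pos.mpr (hzn i)).ne'
    set u : Fin (n+2) → ℝ := Fin.cons 0 fun i => - z i.succ with hu
    set v : Fin (n+2) → ℝ := Fin.cons 0 fun i => α.eval (z i.succ) /
        (z i.succ * ∏ j ∈ Finset.univ.erase i, (z i.succ - z j.succ)) with hv
    have us : ∀ i : Fin (n+1), u i.succ = - z i.succ := fun i => rfl
    have vs : ∀ i : Fin (n+1), v i.succ = α.eval (z i.succ) /
        (z i.succ * ∏ j ∈ Finset.univ.erase i, (z i.succ - z j.succ)) := fun i => rfl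
    refine ⟨(α.eval 0 / β.eval 0, u, v), ⟨rfl, rfl, h0, ?_, ?_, ?_, ?_⟩, ?_⟩
    · intro i hi
      obtain ⟨i, rfl⟩ := Fin.exists_succ_eq.mpr hi
      exact ⟨neg_pos.mpr (hzn i), hz' i⟩
    · intro i j hi hij
      obtain ⟨i, rfl⟩ := Fin.exists_succ_eq.mpr hi.ne'
      obtain ⟨j, rfl⟩ := Fin.exists_succ_eq.mpr (hi.trans hij).ne'
      exact hmono (Fin.succ_lt_succ_iff.mp hij)
    · dsimp only
      rw [mam_adj, hβ]
      simp only [us, neg_neg]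
    · dsimp only
      set A := mammillary n (α.eval 0 / β.eval 0) u v with hA
      have hAd : A.charpoly.natDegree = n + 2 := by
        rw [Matrix.charpoly_natDegree_eq_dim]; simp
      have hAm : A.charpoly.Monic := Matrix.charpoly_monic A
      have hinjz : Function.Injective (Fin.cons 0 fun i => z i.succ : Fin (n+2) → ℝ) := by
        rw [Fin.cons_injective_iff]
        refine ⟨?_, fun i j hij => hmono.injective (by simpa using hij)⟩
        rintro ⟨i, hi⟩
        exact (hzn i).ne hi
      have hlt : (A.charpoly - α).degree < ((Finset.univ.map ⟨_, hinjz⟩ : Finset ℝ).card : ℕ) := by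
        have h1 : A.charpoly.degree = α.degree := by
          rw [degree_eq_natDegree hAm.ne_zero, degree_eq_natDegree hα.ne_zero, hAd, hdeg]
        have := degree_sub_lt_left h1 hAm.ne_zero (by rw [hAm.leadingCoeff, hα.leadingCoeff])
        rw [degree_eq_natDegree hAm.ne_zero, hAd] at this
        rw [Finset.card_map, Finset.card_univ, Fintype.card_fin]
        exact this
      refine eq_of_degree_sub_lt_of_eval_finset_eq _ hlt ?_
      intro x hx
      simp only [Finset.mem_map, Finset.mem_univ, true_and, Function.Embedding.coeFn_mk] at hx
      obtain ⟨i, rfl⟩ := hx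
      refine Fin.cases ?_ (fun i => ?_) i
      · simp only [Fin.cons_zero]
        rw [mam_eval0]
        simp only [us]
        rw [← hβ0, div_mul_cancel₀ _ hβ0']
      · simp only [Fin.cons_succ]
        have := mam_evalz n (α.eval 0 / β.eval 0) u v i
        simp only [us, neg_neg] at this
        rw [hA, this, vs, div_mul_cancel₀ _ (hne i)]
    · rintro ⟨k, u', v'⟩ ⟨hu0, hv0, hk, hpos, hord', hβ', hα'⟩
      dsimp only at hu0 hv0 hk hpos hord' hβ' hα'
      have hmono' : StrictMono fun i : Fin (n+1) => u' i.succ := fun i j hij =>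
        hord' _ _ (Fin.succ_pos _) (Fin.succ_lt_succ_iff.mpr hij)
      have hus : (fun i : Fin (n+1) => u' i.succ) = fun i => - z i.succ := by
        apply roots_inj _ _ _ hmono' hmono
        rw [mam_adj] at hβ'
        rw [hβ', hβ]
        simp only [neg_neg]
      have hus' : ∀ i : Fin (n+1), u' i.succ = - z i.succ := fun i => congrFun hus i
      have hueq : u' = u := by
        funext i
        refine Fin.cases hu0 (fun i => hus' i) i
      have hveq : v' = v := by
        funext i
        refine Fin.cases hv0 (fun i => ?_) i
        have := mam_evalz n k u' v' i
        simp only [hus', neg_neg] at this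
        rw [vs, eq_div_iff (hne i), ← this, hα']
      have hkeq : k = α.eval 0 / β.eval 0 := by
        have := mam_eval0 n k u' v'
        simp only [hus'] at this
        rw [eq_div_iff hβ0', hβ0, ← this, hα']
      rw [hkeq, hueq, hveq]
end

section
/- Let n ≥ 2, let z_2 > z_3 > ⋯ > z_n be pairwise distinct nonzero real numbers, let β(s) = ∏_{i=2}^n (s − z_i), and let α be a monic real polynomial of degree n. Define k_{i1} = −z_i for i = 2,…,n, k_{10} = α(0)/β(0), and k_{1i} = α(z_i)/β_i(z_i) for i = 2,…,n, where β_i(s) = z_i · β(s)/(s − z_i). Then the n×n mammillary matrix A with these parameters, together with B = e_1 and C = e_1ᵀ, satisfies C · adj(sI − A) · B = β(s) and det(sI − A) = α(s) as polynomial identities. -/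
open Polynomial Finset

theorem arrow_univ (n : ℕ) : (Finset.univ : Finset (Fin (n + 2))) =
    insert 0 (Finset.univ.filter (fun l => l ≠ (0 : Fin (n + 2)))) := by
  ext i; by_cases h : i = 0 <;> simp [h]

theorem arrow_sum {R : Type*} [CommRing R] (n : ℕ) (f : Fin (n + 2) → R) :
    ∑ i, f i = f 0 + ∑ i ∈ Finset.univ.filter (fun l => l ≠ (0 : Fin (n + 2))), f i := by
  conv_lhs => rw [arrow_univ n]
  rw [Finset.sum_insert (by simp)]

theorem arrow_prod {R : Type*} [CommRing R] (n : ℕ) (f : Fin (n + 2) → R) :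
    ∏ i, f i = f 0 * ∏ i ∈ Finset.univ.filter (fun l => l ≠ (0 : Fin (n + 2))), f i := by
  conv_lhs => rw [arrow_univ n]
  rw [Finset.prod_insert (by simp)]

theorem arrow_det_s16 {R : Type*} [CommRing R] [IsDomain R] (n : ℕ)
    (M : Matrix (Fin (n + 2)) (Fin (n + 2)) R) 
    (h0 : ∀ i j, i ≠ 0 → j ≠ 0 → i ≠ j → M i j = 0)
    (hd : ∀ i, i ≠ 0 → M i i ≠ 0) :
    M.det = M 0 0 * ∏ i ∈ Finset.univ.filter (fun l => l ≠ (0 : Fin (n + 2))), M i i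
      - ∑ i ∈ Finset.univ.filter (fun l => l ≠ (0 : Fin (n + 2))), M 0 i * M i 0 *
        ∏ j ∈ (Finset.univ.filter (fun l => l ≠ (0 : Fin (n + 2)))).erase i, M j j := by
  set S := Finset.univ.filter (fun l => l ≠ (0 : Fin (n + 2))) with hS
  have memS : ∀ i, i ∈ S ↔ i ≠ 0 := by simp [hS]
  set P := ∏ i ∈ S, M i i with hP
  have hP0 : P ≠ 0 := Finset.prod_ne_zero_iff.mpr fun i hi => hd i ((memS i).1 hi)
  let N : Matrix (Fin (n + 2)) (Fin (n + 2)) R := Matrix.of fun i j =>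
    if j = 0 then (if i = 0 then P else -(M i 0 * ∏ j ∈ S.erase i, M j j))
    else if i = j then 1 else 0
  have hN : N.det = P := by
    rw [Matrix.det_of_isLowerTriangular N]
    · rw [arrow_prod, Finset.prod_eq_one]
      · simp [N]
      · intro i hi
        have := (memS i).1 hi
        simp [N, this]
    · intro i j hij
      have hij : i < j := hij
      have : j ≠ 0 := by rintro rfl; simp at hij
      simp [N, this, hij.ne]
  have hcol : ∀ i j, j ≠ 0 → (M * N) i j = M i j := by
    intro i j hj
    simp [Matrix.mul_apply, N, hj]
  have hcol0 : ∀ i, (M * N) i 0 = M i 0 * P - ∑ k ∈ S, M i k * (M k 0 * ∏ j ∈ S.erase k, M j j) := by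
    intro i
    rw [Matrix.mul_apply, arrow_sum, sub_eq_add_neg, ← Finset.sum_neg_distrib]
    congr 1
    refine Finset.sum_congr rfl fun k hk => ?_
    have := (memS k).1 hk
    simp [N, this]
  have hMN : (M * N).det = (M 0 0 * P - ∑ i ∈ S, M 0 i * M i 0 * ∏ j ∈ S.erase i, M j j) * P := by
    rw [Matrix.det_of_isUpperTriangular]
    · rw [arrow_prod, hcol0]
      congr 1
      · simp only [mul_assoc]
      · exact Finset.prod_congr rfl fun i hi => hcol _ _ ((memS i).1 hi)
    · intro i j hij
      have hij : j < i := hij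
      have hi : i ≠ 0 := by rintro rfl; simp at hij
      by_cases hj : j = 0
      · subst hj
        rw [hcol0, Finset.sum_eq_single i]
        · rw [hP, ← Finset.mul_prod_erase S _ ((memS i).2 hi)]; ring
        · intro k hk hki
          rw [h0 i k hi ((memS k).1 hk) hki.symm, zero_mul]
        · intro h; exact absurd ((memS i).2 hi) h
      · rw [hcol _ _ hj, h0 i j hi hj hij.ne']
  rw [Matrix.det_mul, hN] at hMN
  exact mul_right_cancel₀ hP0 hMN

/-- the explicit parameter formulas
`k_{i1} = −z_i`, `k_{10} = α(0)/β(0)`, `k_{1i} = α(z_i)/β_i(z_i)` (with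
`β_i(z_i) = z_i ∏_{j≠i}(z_i − z_j)`) realize the transfer function `β/α`, where
`β(s) = ∏_{i=2}^n (s − z_i)` with `z₂ > z₃ > ⋯ > z_n` nonzero and `α` monic of
degree `n`. -/
theorem mammillary_realization_formulas
    (n : ℕ) (α : Polynomial ℝ) (hα : α.Monic) (hdeg : α.natDegree = n + 2)
    (z : Fin (n + 2) → ℝ)
    (hzord : ∀ i j : Fin (n + 2), 0 < i → i < j → z j < z i)
    (hzne : ∀ i : Fin (n + 2), i ≠ 0 → z i ≠ 0)
    (β : Polynomial ℝ)
    (hβ : β = ∏ i ∈ Finset.univ.filter (fun i => i ≠ (0 : Fin (n + 2))), (X - C (z i)))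
    (k10 : ℝ) (kin kout : Fin (n + 2) → ℝ)
    (hk10 : k10 = α.eval 0 / β.eval 0)
    (hkin : ∀ i : Fin (n + 2), i ≠ 0 → kin i = -z i)
    (hkout : ∀ i : Fin (n + 2), i ≠ 0 →
      kout i = α.eval (z i) /
        (z i * ∏ j ∈ (Finset.univ.filter (fun j => j ≠ (0 : Fin (n + 2)))).erase i,
          (z i - z j))) :
    (Matrix.charmatrix (mammillary n k10 kin kout)).adjugate 0 0 = β ∧
      (mammillary n k10 kin kout).charpoly = α := by
  classical
  have hM00 : (mammillary n k10 kin kout).charmatrix 0 0 = X + C (k10 +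
      ∑ l ∈ Finset.univ.filter (fun l => l ≠ (0 : Fin (n + 2))), kout l) := by
    rw [Matrix.charmatrix_apply_eq]
    simp only [mammillary, Matrix.of_apply, if_true]
    rw [sub_eq_add_neg, ← C_neg]
    congr 2; ring
  have hM0 : ∀ i, i ≠ 0 → (mammillary n k10 kin kout).charmatrix 0 i = C (z i) := by
    intro i hi
    rw [Matrix.charmatrix_apply_ne _ _ _ hi.symm]
    simp [mammillary, hi, hkin i hi]
  have hM1 : ∀ i, i ≠ 0 → (mammillary n k10 kin kout).charmatrix i 0 = -C (kout i) := by
    intro i hi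
    rw [Matrix.charmatrix_apply_ne _ _ _ hi]
    simp [mammillary, hi]
  have hMd : ∀ i, i ≠ 0 → (mammillary n k10 kin kout).charmatrix i i = X - C (z i) := by
    intro i hi
    rw [Matrix.charmatrix_apply_eq]
    simp [mammillary, hi, hkin i hi]
  have hMz : ∀ i j, i ≠ 0 → j ≠ 0 → i ≠ j →
      (mammillary n k10 kin kout).charmatrix i j = 0 := by
    intro i j hi hj hij
    rw [Matrix.charmatrix_apply_ne _ _ _ hij]
    simp [mammillary, hi, hj, hij]
  constructor
  · rw [Matrix.adjugate_fin_succ_eq_det_submatrix]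
    have : ((mammillary n k10 kin kout).charmatrix.submatrix (Fin.succAbove 0) (Fin.succAbove 0))
        = Matrix.diagonal fun i : Fin (n + 1) => X - C (z i.succ) := by
      ext1 i j
      by_cases h : i = j
      · subst h
        rw [Matrix.diagonal_apply_eq]
        exact hMd i.succ (Fin.succ_ne_zero i)
      · rw [Matrix.diagonal_apply_ne _ h]
        exact hMz i.succ j.succ (Fin.succ_ne_zero i) (Fin.succ_ne_zero j) (by simpa using h)
    rw [this, Matrix.det_diagonal, hβ, Finset.prod_filter]
    conv_rhs => rw [Fin.prod_univ_succ]
    simp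
  · set S := Finset.univ.filter (fun l => l ≠ (0 : Fin (n + 2))) with hS
    have memS : ∀ i, i ∈ S ↔ i ≠ 0 := by simp [hS]
    have hinj : ∀ i j, i ≠ 0 → j ≠ 0 → i ≠ j → z i ≠ z j := by
      intro i j hi hj hij
      rcases lt_or_gt_of_ne hij with h | h
      · exact (hzord i j (Fin.pos_of_ne_zero hi) h).ne'
      · exact (hzord j i (Fin.pos_of_ne_zero hj) h).ne
    have hchar : (mammillary n k10 kin kout).charpoly = (X + C (k10 + ∑ l ∈ S, kout l)) * β
        + ∑ i ∈ S, C (z i * kout i) * ∏ j ∈ S.erase i, (X - C (z j)) := by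
      rw [Matrix.charpoly, arrow_det_s16 n _ hMz
        (fun i hi => by rw [hMd i hi]; exact X_sub_C_ne_zero _), hM00, sub_eq_add_neg,
        ← Finset.sum_neg_distrib, hβ]
      congr 1
      · congr 1
        exact Finset.prod_congr rfl fun i hi => hMd i ((memS i).1 hi)
      · refine Finset.sum_congr rfl fun i hi => ?_
        rw [hM0 i ((memS i).1 hi), hM1 i ((memS i).1 hi), Finset.prod_congr rfl
          fun j hj => hMd j ((memS j).1 (Finset.mem_of_mem_erase hj)), C_mul]
        ring
    have hev : ∀ i : Fin (n + 2), (mammillary n k10 kin kout).charpoly.eval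
        (if i = 0 then 0 else z i) = α.eval (if i = 0 then 0 else z i) := by
      intro i
      rw [hchar]
      by_cases hi : i = 0
      · have hb : β.eval 0 = ∏ j ∈ S, (- z j) := by simp [hβ, eval_prod]
        have hb0 : β.eval 0 ≠ 0 := by
          rw [hb]
          exact Finset.prod_ne_zero_iff.mpr fun j hj => neg_ne_zero.mpr (hzne j ((memS j).1 hj))
        simp only [hi, if_true, eval_add, eval_mul, eval_X, eval_C, eval_finsetSum, eval_prod,
          eval_sub, zero_sub, zero_add]
        have : ∀ j ∈ S, z j * kout j * ∏ l ∈ S.erase j, (- z l) = - (kout j * β.eval 0) := by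
          intro j hj
          rw [hb, ← Finset.mul_prod_erase S _ hj]; ring
        rw [Finset.sum_congr rfl this, Finset.sum_neg_distrib, ← Finset.sum_mul, hk10]
        field_simp
        ring
      · simp only [hi, if_false, eval_add, eval_mul, eval_X, eval_C, eval_finsetSum, eval_prod,
          eval_sub]
        have hb : β.eval (z i) = 0 := by
          rw [hβ, eval_prod]
          exact Finset.prod_eq_zero ((memS i).2 hi) (by simp)
        rw [hb, mul_zero, zero_add, Finset.sum_eq_single i]
        · have hp : ∏ j ∈ S.erase i, (z i - z j) ≠ 0 :=
            Finset.prod_ne_zero_iff.mpr fun j hj => sub_ne_zero.mpr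
              (hinj i j hi ((memS j).1 (Finset.mem_of_mem_erase hj)) (Finset.ne_of_mem_erase hj).symm)
          have := hzne i hi
          rw [hkout i hi]
          field_simp
        · intro j hj hji
          rw [Finset.prod_eq_zero (Finset.mem_erase.mpr ⟨hji.symm, (memS i).2 hi⟩) (by simp), mul_zero]
        · intro h; exact absurd ((memS i).2 hi) h
    have hcm := Matrix.charpoly_monic (mammillary n k10 kin kout)
    have hcd : (mammillary n k10 kin kout).charpoly.natDegree = n + 2 := by
      rw [Matrix.charpoly_natDegree_eq_dim, Fintype.card_fin]
    refine Polynomial.eq_of_degree_sub_lt_of_eval_index_eq (s := Finset.univ)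
      (v := fun i : Fin (n + 2) => if i = 0 then 0 else z i) ?_ ?_ (fun i _ => hev i)
    · intro i _ j _ hij
      by_contra hne
      by_cases hi : i = 0 <;> by_cases hj : j = 0 <;> simp only [hi, hj, if_true, if_false] at hij
      · exact hne (hi.trans hj.symm)
      · exact hzne j hj hij.symm
      · exact hzne i hi hij
      · exact hinj i j hi hj hne hij
    · have hlt := Polynomial.degree_sub_lt_left (p := (mammillary n k10 kin kout).charpoly) (q := α)
        (by rw [degree_eq_natDegree hcm.ne_zero, degree_eq_natDegree hα.ne_zero, hcd, hdeg])
        hcm.ne_zero (by rw [hcm.leadingCoeff, hα.leadingCoeff])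
      rw [degree_eq_natDegree hcm.ne_zero, hcd] at hlt
      simpa using hlt
end
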